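/- arXiv:2603.06132 — 5 statements merged into one kernel-verified Lean document; each statement's English description precedes it below -/
import Mathlib

section
/- Let A be an ℕ-graded K-algebra generated in degrees 0 and 1. If *₁ and *₂ are two 0-equivariant star products on A such that f *₁ a = f *₂ a for all f ∈ A_1 and all a ∈ A, then *₁ = *₂. In other words, a 0-equivariant star product on A is uniquely determined by the map μ^L : A_1 → End_K(A), μ^L_f(a) = f * a − fa. -/
/-- If a submodule `E` contains the degree `n` part of `1`, and passing from `x` to `a * x` keeps the
degree `n` part in `E` for all generators `a` of `A`, then `E` contains all of degree `n`. -/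
theorem GradedAlgebra.le_of_adjoin_eq_top {K A : Type*} [CommSemiring K] [Semiring A] [Algebra K A]
    (𝒜 : ℕ → Submodule K A) [GradedAlgebra 𝒜] {s : Set A} (hs : Algebra.adjoin K s = ⊤)
    (E : Submodule K A) (n : ℕ) (one : GradedAlgebra.proj 𝒜 n 1 ∈ E)
    (mul : ∀ a ∈ s, ∀ x, GradedAlgebra.proj 𝒜 n x ∈ E → GradedAlgebra.proj 𝒜 n (a * x) ∈ E) :
    𝒜 n ≤ E := by
  have key : ∀ a : A, ∀ x, GradedAlgebra.proj 𝒜 n x ∈ E → GradedAlgebra.proj 𝒜 n (a * x) ∈ E := by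
    intro a
    have ha : a ∈ Algebra.adjoin K s := hs ▸ Algebra.mem_top
    induction ha using Algebra.adjoin_induction with
    | mem a ha => exact mul a ha
    | algebraMap r =>
      intro x hx
      rw [← Algebra.smul_def, map_smul]
      exact E.smul_mem r hx
    | add a b _ _ iha ihb =>
      intro x hx
      rw [add_mul, map_add]
      exact E.add_mem (iha x hx) (ihb x hx)
    | mul a b _ _ iha ihb =>
      intro x hx
      rw [mul_assoc]
      exact iha _ (ihb x hx)
  intro a ha
  have h := key a 1 one
  rwa [mul_one, GradedAlgebra.proj_apply, DirectSum.decompose_of_mem_same 𝒜 ha] at h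

/-- On an ℕ-graded `K`-algebra generated in degrees `0` and `1`,
a `0`-equivariant star product is uniquely determined by the left lower-order
term maps `μᴸ_f(a) = f * a - f·a` for `f ∈ A₁`: two `0`-equivariant star
products which agree on `A₁ * A` coincide. -/
theorem zero_equivariant_star_determined_by_muL
    {K A : Type*} [Field K] [Ring A] [Algebra K A]
    (𝒜 : ℕ → Submodule K A) [GradedAlgebra 𝒜]
    (hgen : Algebra.adjoin K ((𝒜 0 : Set A) ∪ (𝒜 1 : Set A)) = ⊤)
    (star1 star2 : A →ₗ[K] A →ₗ[K] A)
    (hassoc1 : ∀ a b c : A, star1 (star1 a b) c = star1 a (star1 b c))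
    (hassoc2 : ∀ a b c : A, star2 (star2 a b) c = star2 a (star2 b c))
    (hlow1 : ∀ (m n : ℕ) (a b : A), a ∈ 𝒜 m → b ∈ 𝒜 n →
      star1 a b - a * b ∈ ⨆ k < m + n, 𝒜 k)
    (hlow2 : ∀ (m n : ℕ) (a b : A), a ∈ 𝒜 m → b ∈ 𝒜 n →
      star2 a b - a * b ∈ ⨆ k < m + n, 𝒜 k)
    (h0eq1 : ∀ (h a : A), h ∈ 𝒜 0 → star1 a h = a * h ∧ star1 h a = h * a)
    (h0eq2 : ∀ (h a : A), h ∈ 𝒜 0 → star2 a h = a * h ∧ star2 h a = h * a)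
    (hagree : ∀ f ∈ 𝒜 1, ∀ a : A, star1 f a = star2 f a) :
    star1 = star2 := by
  have star_mem : ∀ a b : A, star1 a = star2 a → star1 b = star2 b →
      star1 (star1 a b) = star2 (star1 a b) := by
    intro a b ha hb
    ext x
    rw [hassoc1, hb, ha, hassoc2]
  have zero_mem : ∀ a ∈ 𝒜 0, star1 a = star2 a := by
    intro a ha
    ext x
    rw [(h0eq1 a x ha).2, (h0eq2 a x ha).2]
  have one_mem : ∀ a ∈ 𝒜 1, star1 a = star2 a := fun a ha ↦ LinearMap.ext (hagree a ha)
  have homogeneous_le : ∀ n, 𝒜 n ≤ LinearMap.eqLocus star1 star2 := by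
    intro n
    induction n using Nat.strong_induction_on with
    | _ n ih =>
    refine GradedAlgebra.le_of_adjoin_eq_top 𝒜 hgen _ n ?_ ?_
    · rw [GradedAlgebra.proj_apply]
      rcases eq_or_ne 0 n with rfl | hn
      · exact zero_mem _ (SetLike.coe_mem _)
      · rw [DirectSum.decompose_of_mem_ne 𝒜 SetLike.GradedOne.one_mem hn]
        exact Submodule.zero_mem _
    · rintro a (ha | ha) x hx
      · rw [GradedAlgebra.proj_apply] at hx ⊢
        have h := DirectSum.coe_decompose_mul_add_of_left_mem 𝒜 (j := n) (b := x) ha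
        rw [zero_add] at h
        rw [h, ← (h0eq1 a _ ha).2]
        exact star_mem _ _ (zero_mem a ha) hx
      · rw [GradedAlgebra.proj_apply]
        cases n with
        | zero =>
          rw [DirectSum.coe_decompose_mul_of_left_mem_of_not_le 𝒜 ha (by simp)]
          exact Submodule.zero_mem _
        | succ m =>
          have h := DirectSum.coe_decompose_mul_add_of_left_mem 𝒜 (j := m) (b := x) ha
          rw [add_comm 1 m] at h
          rw [h]
          have hy := SetLike.coe_mem (DirectSum.decompose 𝒜 x m)
          generalize (DirectSum.decompose 𝒜 x m : A) = y at hy ⊢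
          have lower : star1 a y - a * y ∈ LinearMap.eqLocus star1 star2 :=
            (iSup₂_le fun k hk ↦ ih k (by omega) : ⨆ k < 1 + m, 𝒜 k ≤ _) (hlow1 1 m a y ha hy)
          have top : star1 a y ∈ LinearMap.eqLocus star1 star2 :=
            star_mem a y (one_mem a ha) (ih m (by omega) hy)
          simpa using Submodule.sub_mem _ top lower
  have le : (⊤ : Submodule K A) ≤ LinearMap.eqLocus star1 star2 := by
    rw [← (DirectSum.Decomposition.isInternal 𝒜).submodule_iSup_eq_top]
    exact iSup_le homogeneous_le
  exact LinearMap.ext fun a ↦ le (Submodule.mem_top (x := a))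
end

section
/- Let A be an ℕ-graded K-algebra generated in degrees 0 and 1, and let R ⊆ A be a graded subalgebra such that A_0·R = R·A_0 = A (where A_0·R denotes the K-span of products hr with h ∈ A_0, r ∈ R, and similarly for R·A_0). If *₁ and *₂ are two 0-equivariant star products on A such that f *₁ b = f *₂ b for all f ∈ R_1 and all b ∈ R, then *₁ = *₂. -/
/-- The elements on which left multiplication by two bilinear products agrees. -/
def leftAgreement {K A : Type*} [CommSemiring K] [AddCommMonoid A] [Module K A]
    (star1 star2 : A →ₗ[K] A →ₗ[K] A) : Submodule K A :=
  LinearMap.eqLocus star1 star2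

theorem mem_leftAgreement {K A : Type*} [CommSemiring K] [AddCommMonoid A] [Module K A]
    {star1 star2 : A →ₗ[K] A →ₗ[K] A} {a : A} :
    a ∈ leftAgreement star1 star2 ↔ ∀ b, star1 a b = star2 a b := by
  rw [leftAgreement, LinearMap.mem_eqLocus, LinearMap.ext_iff]

theorem star_mem_leftAgreement {K A : Type*} [CommSemiring K] [AddCommMonoid A] [Module K A]
    {star1 star2 : A →ₗ[K] A →ₗ[K] A}
    (hassoc1 : ∀ a b c : A, star1 (star1 a b) c = star1 a (star1 b c))
    (hassoc2 : ∀ a b c : A, star2 (star2 a b) c = star2 a (star2 b c))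
    {a b : A} (ha : a ∈ leftAgreement star1 star2) (hb : b ∈ leftAgreement star1 star2) :
    star1 a b ∈ leftAgreement star1 star2 := by
  rw [mem_leftAgreement] at *
  intro c
  rw [hassoc1, hb, ha, ha, hassoc2]

/-- A submodule closed under a filtered deformation of the product contains everything
as soon as it contains generators of degrees `0` and `1`. -/
theorem eq_top_of_star_closed {K A : Type*} [CommRing K] [Ring A] [Algebra K A]
    (𝒜 : ℕ → Submodule K A) [GradedAlgebra 𝒜]
    (hgen : Algebra.adjoin K ((𝒜 0 : Set A) ∪ (𝒜 1 : Set A)) = ⊤)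
    (star : A →ₗ[K] A →ₗ[K] A)
    (hlow : ∀ (m n : ℕ) (a b : A), a ∈ 𝒜 m → b ∈ 𝒜 n →
      star a b - a * b ∈ ⨆ k < m + n, 𝒜 k)
    (S : Submodule K A) (hS : ∀ a ∈ S, ∀ b ∈ S, star a b ∈ S)
    (h0 : 𝒜 0 ≤ S) (h1 : 𝒜 1 ≤ S) : S = ⊤ := by
  have hmul : ∀ n, (∀ k < n, 𝒜 k ≤ S) → ∀ d m, d + m ≤ n → ∀ g ∈ 𝒜 d, ∀ y ∈ 𝒜 m,
      g ∈ S → y ∈ S → g * y ∈ S := by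
    intro n ih d m hdm g hg y hy hgS hyS
    have hF : (⨆ k < d + m, 𝒜 k) ≤ S := iSup₂_le fun k hk => ih k (by omega)
    simpa using S.sub_mem (hS g hgS y hyS) (hF (hlow d m g y hg hy))
  have hmono : ∀ n, (∀ k < n, 𝒜 k ≤ S) →
      ∀ x ∈ Submonoid.closure ((𝒜 0 : Set A) ∪ (𝒜 1 : Set A)),
        ∃ m, x ∈ 𝒜 m ∧ (m ≤ n → x ∈ S) := by
    intro n ih x hx
    induction hx using Submonoid.closure_induction_left with
    | one => exact ⟨0, SetLike.one_mem_graded 𝒜, fun _ => h0 (SetLike.one_mem_graded 𝒜)⟩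
    | mul_left g hg y _ hy =>
      obtain ⟨m, hym, hyS⟩ := hy
      obtain ⟨d, hgd, hgS⟩ : ∃ d, g ∈ 𝒜 d ∧ g ∈ S := by
        rcases hg with hg | hg
        · exact ⟨0, hg, h0 hg⟩
        · exact ⟨1, hg, h1 hg⟩
      exact ⟨d + m, SetLike.mul_mem_graded hgd hym,
        fun hle => hmul n ih d m hle g hgd y hym hgS (hyS (by omega))⟩
  have hspan : Submodule.span K
      (Submonoid.closure ((𝒜 0 : Set A) ∪ (𝒜 1 : Set A)) : Set A) = ⊤ := by
    rw [← Algebra.adjoin_eq_span, hgen, Algebra.top_toSubmodule]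
  have hdeg : ∀ n, 𝒜 n ≤ S := by
    intro n
    induction n using Nat.strong_induction_on with
    | _ n ih =>
      have hle : (⊤ : Submodule K A) ≤ S.comap (GradedAlgebra.proj 𝒜 n) := by
        rw [← hspan, Submodule.span_le]
        intro x hx
        obtain ⟨m, hxm, hxS⟩ := hmono n ih x hx
        change (DirectSum.decompose 𝒜 x n : A) ∈ S
        by_cases hmn : m = n
        · subst hmn
          rw [DirectSum.decompose_of_mem_same 𝒜 hxm]
          exact hxS le_rfl
        · rw [DirectSum.decompose_of_mem_ne 𝒜 hxm hmn]
          exact S.zero_mem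
      intro a ha
      have hproj : (DirectSum.decompose 𝒜 a n : A) ∈ S := hle (Submodule.mem_top (x := a))
      rwa [DirectSum.decompose_of_mem_same 𝒜 ha] at hproj
  rw [eq_top_iff, ← (DirectSum.Decomposition.isInternal 𝒜).submodule_iSup_eq_top]
  exact iSup_le hdeg

/-- Let `A` be an ℕ-graded `K`-algebra generated in degrees `0`
and `1` and let `R ⊆ A` be a graded subalgebra with `A₀·R = R·A₀ = A`. Then a
`0`-equivariant star product on `A` is uniquely determined by the maps
`μᴸ_f : R → A`, `μᴸ_f(b) = f * b - f·b`, for `f ∈ R₁`: two `0`-equivariant star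
products agreeing on `R₁ * R` coincide. -/
theorem zero_equivariant_star_determined_by_muL_on_R
    {K A : Type*} [Field K] [Ring A] [Algebra K A]
    (𝒜 : ℕ → Submodule K A) [GradedAlgebra 𝒜]
    (hgen : Algebra.adjoin K ((𝒜 0 : Set A) ∪ (𝒜 1 : Set A)) = ⊤)
    (R : Subalgebra K A)
    (hRgraded : ∀ r ∈ R, ∀ n : ℕ, (DirectSum.decompose 𝒜 r n : A) ∈ R)
    (hA0R : Submodule.span K {x : A | ∃ h ∈ 𝒜 0, ∃ r ∈ R, x = h * r} = ⊤)
    (hRA0 : Submodule.span K {x : A | ∃ r ∈ R, ∃ h ∈ 𝒜 0, x = r * h} = ⊤)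
    (star1 star2 : A →ₗ[K] A →ₗ[K] A)
    (hassoc1 : ∀ a b c : A, star1 (star1 a b) c = star1 a (star1 b c))
    (hassoc2 : ∀ a b c : A, star2 (star2 a b) c = star2 a (star2 b c))
    (hlow1 : ∀ (m n : ℕ) (a b : A), a ∈ 𝒜 m → b ∈ 𝒜 n →
      star1 a b - a * b ∈ ⨆ k < m + n, 𝒜 k)
    (hlow2 : ∀ (m n : ℕ) (a b : A), a ∈ 𝒜 m → b ∈ 𝒜 n →
      star2 a b - a * b ∈ ⨆ k < m + n, 𝒜 k)
    (h0eq1 : ∀ (h a : A), h ∈ 𝒜 0 → star1 a h = a * h ∧ star1 h a = h * a)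
    (h0eq2 : ∀ (h a : A), h ∈ 𝒜 0 → star2 a h = a * h ∧ star2 h a = h * a)
    (hagree : ∀ f : A, f ∈ R → f ∈ 𝒜 1 → ∀ b ∈ R, star1 f b = star2 f b) :
    star1 = star2 := by
  have h0 : 𝒜 0 ≤ leftAgreement star1 star2 := fun h hh =>
    mem_leftAgreement.2 fun b => by rw [(h0eq1 h b hh).2, (h0eq2 h b hh).2]
  have hR1 : ∀ f ∈ R, f ∈ 𝒜 1 → f ∈ leftAgreement star1 star2 := by
    intro f hfR hf
    refine LinearMap.ext_on hRA0 ?_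
    rintro _ ⟨r, hr, h, hh, rfl⟩
    rw [← (h0eq1 h r hh).1, ← hassoc1, (h0eq1 h _ hh).1, (h0eq1 h r hh).1,
      ← (h0eq2 h r hh).1, ← hassoc2, (h0eq2 h _ hh).1, hagree f hfR hf r hr]
  have hclosed : ∀ a ∈ leftAgreement star1 star2, ∀ b ∈ leftAgreement star1 star2,
      star1 a b ∈ leftAgreement star1 star2 := fun _ ha _ hb =>
    star_mem_leftAgreement hassoc1 hassoc2 ha hb
  have h1 : 𝒜 1 ≤ leftAgreement star1 star2 := by
    have hle : (⊤ : Submodule K A) ≤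
        (leftAgreement star1 star2).comap (GradedAlgebra.proj 𝒜 1) := by
      rw [← hA0R, Submodule.span_le]
      rintro _ ⟨h, hh, r, hr, rfl⟩
      change (DirectSum.decompose 𝒜 (h * r) 1 : A) ∈ leftAgreement star1 star2
      have hcomp := DirectSum.coe_decompose_mul_add_of_left_mem 𝒜 (j := 1) (b := r) hh
      rw [zero_add] at hcomp
      rw [hcomp, ← (h0eq1 h _ hh).2]
      exact hclosed h (h0 hh) _ (hR1 _ (hRgraded r hr 1) (SetLike.coe_mem _))
    intro a ha
    have hproj : (DirectSum.decompose 𝒜 a 1 : A) ∈ leftAgreement star1 star2 :=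
      hle (Submodule.mem_top (x := a))
    rwa [DirectSum.decompose_of_mem_same 𝒜 ha] at hproj
  exact LinearMap.eqLocus_eq_top.1
    (eq_top_of_star_closed 𝒜 hgen star1 hlow1 _ hclosed h0 h1)
end

section
/- Let A be an ℕ-graded K-algebra whose degree-zero component A_0 carries a Hopf algebra structure over K (with comultiplication Δ(h) = h_(1) ⊗ h_(2), counit ε and antipode S) whose multiplication and unit are those inherited from A, and let * be a 0-equivariant star product on A. Then (A,*) is a right A_0-module algebra under the right adjoint action: ad_r(h)(x * y) = ad_r(h_(1))(x) * ad_r(h_(2))(y) and ad_r(h)(1) = ε(h)·1 for all h ∈ A_0 and all x, y ∈ A, where ad_r(h)(x) = S(h_(1)) x h_(2). -/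
/-- The right adjoint action `ad_r(h)(x) = S(h₍₁₎) x h₍₂₎` of a Hopf algebra `H`
on an algebra `A`, along an algebra map `ι : H →ₐ[K] A`, packaged as a linear
map in `h`. -/
noncomputable def adrL {K A H : Type*} [CommSemiring K] [Semiring A] [Algebra K A]
    [Semiring H] [HopfAlgebra K H] (ι : H →ₐ[K] A) (x : A) : H →ₗ[K] A :=
  (TensorProduct.lift
    (LinearMap.mk₂ K
      (fun h₁ h₂ => ι (HopfAlgebra.antipode (R := K) h₁) * x * ι h₂)
      (fun m₁ m₂ n => by simp [map_add, add_mul])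
      (fun c m n => by simp [map_smul, smul_mul_assoc])
      (fun m n₁ n₂ => by simp [map_add, mul_add])
      (fun c m n => by simp [map_smul, mul_smul_comm]))) ∘ₗ
    (Coalgebra.comul (R := K))

open Coalgebra HopfAlgebra TensorProduct

section AdjointAction

variable {K A H : Type*} [CommSemiring K] [Semiring A] [Algebra K A]
  [Semiring H] [HopfAlgebra K H] (ι : H →ₐ[K] A)

/-- The linear map `h ⊗ k ↦ S(h) x k` whose composite with the comultiplication is `adrL ι x`. -/
noncomputable def antipodeSandwich (x : A) : H ⊗[K] H →ₗ[K] A :=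
  LinearMap.mul' K A ∘ₗ
    TensorProduct.map (LinearMap.mulRight K x ∘ₗ ι.toLinearMap ∘ₗ antipode K) ι.toLinearMap

@[simp]
theorem antipodeSandwich_tmul (x : A) (h k : H) :
    antipodeSandwich ι x (h ⊗ₜ[K] k) = ι (antipode K h) * x * ι k := by
  simp [antipodeSandwich]

theorem adrL_eq_sum (x : A) {h : H} {κ : Type*} (r : Repr K h κ) :
    adrL ι x h = ∑ i ∈ r.index, ι (antipode K (r.left i)) * x * ι (r.right i) := by
  simp [adrL, ← r.eq]

theorem adrL_one (h : H) : adrL ι (1 : A) h = counit (R := K) h • (1 : A) := by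
  rw [adrL_eq_sum ι 1 (ℛ K h)]
  simp only [mul_one, ← map_mul, ← map_sum, sum_antipode_mul_eq_smul, map_smul, map_one]

/-- The identity `h₍₁₎ ad_r(h₍₂₎)(y) = y h`. -/
theorem sum_mul_adrL (y : A) {h : H} {κ : Type*} (r : Repr K h κ) :
    ∑ i ∈ r.index, ι (r.left i) * adrL ι y (r.right i) = y * ι h := by
  have key := congrArg
    (LinearMap.mul' K A ∘ₗ TensorProduct.map ι.toLinearMap (antipodeSandwich ι y))
    (sum_tmul_tmul_eq r (fun i => ℛ K (r.left i)) (fun i => ℛ K (r.right i)))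
  simp only [map_sum, LinearMap.comp_apply, TensorProduct.map_tmul, LinearMap.mul'_apply,
    antipodeSandwich_tmul, AlgHom.toLinearMap_apply] at key
  calc ∑ i ∈ r.index, ι (r.left i) * adrL ι y (r.right i)
      = ∑ i ∈ r.index, ∑ j ∈ (ℛ K (r.left i)).index, ι ((ℛ K (r.left i)).left j) *
          (ι (antipode K ((ℛ K (r.left i)).right j)) * y * ι (r.right i)) := by
        rw [key]
        simp only [adrL_eq_sum ι y (ℛ K _), Finset.mul_sum]
    _ = ∑ i ∈ r.index, ι (counit (R := K) (r.left i) • 1) * y * ι (r.right i) := by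
        simp only [← sum_mul_antipode_eq_smul (ℛ K (r.left _)), map_sum, map_mul,
          Finset.sum_mul, mul_assoc]
    _ = y * ι (∑ i ∈ r.index, counit (R := K) (r.left i) • r.right i) := by
        simp [Finset.mul_sum]
    _ = y * ι h := by rw [sum_counit_smul]

/-- If a bilinear product is compatible with left and right multiplication by `ι h` and is
balanced over `H`, then the right adjoint action satisfies the module algebra identity for it. -/
theorem adrL_bilinear (m : A →ₗ[K] A →ₗ[K] A)
    (hleft : ∀ (h : H) (a b : A), m (ι h * a) b = ι h * m a b)
    (hright : ∀ (h : H) (a b : A), m a (b * ι h) = m a b * ι h)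
    (hbal : ∀ (h : H) (a b : A), m (a * ι h) b = m a (ι h * b)) (h : H) (x y : A) :
    adrL ι (m x y) h =
      TensorProduct.lift (m.compl₁₂ (adrL ι x) (adrL ι y)) (comul (R := K) h) := by
  have key := congrArg
    (TensorProduct.lift m ∘ₗ TensorProduct.map (antipodeSandwich ι x) (adrL ι y) ∘ₗ
      (TensorProduct.assoc K H H H).symm.toLinearMap)
    (sum_tmul_tmul_eq (ℛ K h) (fun i => ℛ K ((ℛ K h).left i)) (fun i => ℛ K ((ℛ K h).right i)))
  simp only [map_sum, LinearMap.comp_apply, LinearEquiv.coe_coe, TensorProduct.assoc_symm_tmul,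
    TensorProduct.map_tmul, TensorProduct.lift.tmul, antipodeSandwich_tmul] at key
  conv_rhs => rw [← (ℛ K h).eq]
  simp only [map_sum, TensorProduct.lift.tmul, LinearMap.compl₁₂_apply]
  simp only [adrL_eq_sum ι x (ℛ K _), map_sum, LinearMap.sum_apply]
  rw [key, adrL_eq_sum ι _ (ℛ K h)]
  refine Finset.sum_congr rfl fun i _ => ?_
  simp only [hbal, hleft]
  rw [← Finset.mul_sum, ← map_sum, sum_mul_adrL, hright, mul_assoc]

end AdjointAction

/-- Let `A` be an ℕ-graded `K`-algebra whose degree-zero part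
`A₀` carries a Hopf algebra structure with multiplication and unit inherited
from `A` (realized by a Hopf algebra `H` embedded via `ι : H →ₐ[K] A` onto
`A₀`), and let `*` be a `0`-equivariant star product on `A`. Then `(A, *)` is a
right `A₀`-module algebra under the right adjoint action:
`ad_r(h)(x * y) = ad_r(h₍₁₎)(x) * ad_r(h₍₂₎)(y)` and `ad_r(h)(1) = ε(h)·1`. -/
theorem star_product_right_module_algebra
    {K A H : Type*} [Field K] [Ring A] [Algebra K A]
    [Ring H] [HopfAlgebra K H]
    (𝒜 : ℕ → Submodule K A) [GradedAlgebra 𝒜]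
    (ι : H →ₐ[K] A)
    (hι : Function.Injective ι)
    (hιrange : ∀ x : A, x ∈ 𝒜 0 ↔ ∃ h : H, ι h = x)
    (star : A →ₗ[K] A →ₗ[K] A)
    (hassoc : ∀ a b c : A, star (star a b) c = star a (star b c))
    (hlow : ∀ (m n : ℕ) (a b : A), a ∈ 𝒜 m → b ∈ 𝒜 n →
      star a b - a * b ∈ ⨆ k < m + n, 𝒜 k)
    (h0eq : ∀ (h a : A), h ∈ 𝒜 0 → star a h = a * h ∧ star h a = h * a) :
    (∀ (h : H) (x y : A),
      adrL ι (star x y) h =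
        TensorProduct.lift (star.compl₁₂ (adrL ι x) (adrL ι y))
          (Coalgebra.comul (R := K) h)) ∧
    (∀ h : H, adrL ι (1 : A) h = (Coalgebra.counit (R := K) h) • (1 : A)) := by
  have hmem (h : H) : ι h ∈ 𝒜 0 := (hιrange _).2 ⟨h, rfl⟩
  have mul_eq_star (h : H) (a : A) : ι h * a = star (ι h) a := (h0eq _ a (hmem h)).2.symm
  have star_eq_mul (h : H) (a : A) : a * ι h = star a (ι h) := (h0eq _ a (hmem h)).1.symm
  refine ⟨adrL_bilinear ι star ?_ ?_ ?_, adrL_one ι⟩ <;> intro h a b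
  · rw [mul_eq_star, mul_eq_star, hassoc]
  · rw [star_eq_mul, star_eq_mul, hassoc]
  · rw [mul_eq_star, star_eq_mul, hassoc]
end

section
/- Let A be an ℕ-graded K-algebra generated in degrees 0 and 1 and let * be a 0-equivariant and ℤ/2-equivariant star product on A. Then * is short if and only if for every f ∈ A_1, every n ∈ ℕ and every a ∈ A_n one has f * a − fa ∈ A_{n−1} and a * f − af ∈ A_{n−1} (where A_{−1} := 0). -/
section GradedAlgebraLemmas

variable {K A : Type*} [Field K] [Ring A] [Algebra K A] (𝒜 : ℕ → Submodule K A)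
  [GradedAlgebra 𝒜]

/-- An element lies in the sum of the graded pieces indexed by `p` iff its components outside `p`
vanish. -/
lemma mem_iSup_graded_iff (p : ℕ → Prop) (x : A) :
    x ∈ ⨆ (k : ℕ) (_ : p k), 𝒜 k ↔ ∀ k, ¬ p k → (DirectSum.decompose 𝒜 x k : A) = 0 := by
  constructor
  · intro hx k hk
    have hle : ⨆ (k : ℕ) (_ : p k), 𝒜 k ≤ LinearMap.ker (GradedAlgebra.proj 𝒜 k) := by
      refine iSup₂_le fun i hi y hy => ?_
      rw [LinearMap.mem_ker, GradedAlgebra.proj_apply]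
      exact DirectSum.decompose_of_mem_ne 𝒜 hy (by rintro rfl; exact hk hi)
    simpa [GradedAlgebra.proj_apply] using hle hx
  · intro h
    classical
    rw [← DirectSum.sum_support_decompose 𝒜 x]
    refine Submodule.sum_mem _ fun i _ => ?_
    by_cases hi : p i
    · exact Submodule.mem_iSup_of_mem i (Submodule.mem_iSup_of_mem hi (SetLike.coe_mem _))
    · rw [h i hi]
      exact Submodule.zero_mem _

lemma graded_mul_le (i j : ℕ) : 𝒜 i * 𝒜 j ≤ 𝒜 (i + j) :=
  Submodule.mul_le.2 fun _ ha _ hb => SetLike.mul_mem_graded ha hb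

lemma graded_succ_le_one_mul
    (hgen : Algebra.adjoin K ((𝒜 0 : Set A) ∪ (𝒜 1 : Set A)) = ⊤) (m : ℕ) :
    𝒜 (m + 1) ≤ 𝒜 1 * 𝒜 m := by
  have key : ∀ x ∈ Algebra.adjoin K ((𝒜 0 : Set A) ∪ (𝒜 1 : Set A)), ∀ m : ℕ,
      (DirectSum.decompose 𝒜 x (m + 1) : A) ∈ 𝒜 1 * 𝒜 m := by
    intro x hx
    have degree_zero : ∀ y ∈ 𝒜 0, ∀ m : ℕ,
        (DirectSum.decompose 𝒜 y (m + 1) : A) ∈ 𝒜 1 * 𝒜 m := by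
      intro y hy m
      rw [DirectSum.decompose_of_mem_ne 𝒜 hy (by omega)]
      exact Submodule.zero_mem _
    induction hx using Algebra.adjoin_induction with
    | mem x hx =>
      rcases hx with hx | hx
      · exact degree_zero x hx
      · rintro (_ | m)
        · rw [DirectSum.decompose_of_mem_same 𝒜 hx]
          simpa using Submodule.mul_mem_mul hx (SetLike.one_mem_graded 𝒜)
        · rw [DirectSum.decompose_of_mem_ne 𝒜 hx (by omega)]
          exact Submodule.zero_mem _
    | algebraMap r => exact degree_zero _ (SetLike.algebraMap_mem_graded 𝒜 r)
    | add x y _ _ hx hy =>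
      intro m
      rw [DirectSum.decompose_add]
      exact Submodule.add_mem _ (hx m) (hy m)
    | mul x y _ _ hx hy =>
      intro m
      classical
      rw [DirectSum.decompose_mul, DirectSum.coe_mul_apply]
      refine Submodule.sum_mem _ ?_
      rintro ⟨i, j⟩ hij
      have hij : i + j = m + 1 := (Finset.mem_filter.1 hij).2
      rcases i with _ | i
      · obtain rfl : j = m + 1 := by omega
        have h := Submodule.mul_mem_mul (SetLike.coe_mem (DirectSum.decompose 𝒜 x 0)) (hy m)
        rw [← mul_assoc] at h
        exact SetLike.le_def.1 (mul_le_mul' (by simpa using graded_mul_le 𝒜 0 1) le_rfl) h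
      · obtain rfl : m = i + j := by omega
        have h := Submodule.mul_mem_mul (hx i) (SetLike.coe_mem (DirectSum.decompose 𝒜 y j))
        rw [mul_assoc] at h
        exact SetLike.le_def.1 (mul_le_mul' le_rfl (graded_mul_le 𝒜 i j)) h
  intro x hx
  have h := key x (hgen ▸ Algebra.mem_top) m
  rwa [DirectSum.decompose_of_mem_same 𝒜 hx] at h

lemma graded_succ_le_mul_one
    (hgen : Algebra.adjoin K ((𝒜 0 : Set A) ∪ (𝒜 1 : Set A)) = ⊤) (m : ℕ) :
    𝒜 (m + 1) ≤ 𝒜 m * 𝒜 1 := by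
  induction m with
  | zero =>
    intro x hx
    simpa using Submodule.mul_mem_mul (SetLike.one_mem_graded 𝒜) hx
  | succ m ih =>
    calc 𝒜 (m + 1 + 1) ≤ 𝒜 1 * 𝒜 (m + 1) := graded_succ_le_one_mul 𝒜 hgen _
      _ ≤ 𝒜 1 * (𝒜 m * 𝒜 1) := mul_le_mul' le_rfl ih
      _ = 𝒜 1 * 𝒜 m * 𝒜 1 := (mul_assoc _ _ _).symm
      _ ≤ 𝒜 (m + 1) * 𝒜 1 :=
        mul_le_mul' (add_comm 1 m ▸ graded_mul_le 𝒜 1 m) le_rfl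

end GradedAlgebraLemmas

/-- If left multiplication by degree one elements lowers the degree by at most one, and each graded
piece is obtained, up to terms two degrees lower, from the previous one by multiplication with
degree one elements, then left multiplication by degree `m` elements lowers the degree by at most
`m`. -/
lemma mul_mem_iSup_ge_of_degree_one {K A : Type*} [Field K] [Ring A] [Algebra K A]
    (𝒜 : ℕ → Submodule K A) (S : A →ₗ[K] A →ₗ[K] A)
    (hassoc : ∀ a b c : A, S (S a b) c = S a (S b c))
    (hzero : ∀ h ∈ 𝒜 0, ∀ (n : ℕ), ∀ b ∈ 𝒜 n, S h b ∈ 𝒜 n)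
    (hone : ∀ f ∈ 𝒜 1, ∀ (n : ℕ), ∀ b ∈ 𝒜 n, S f b ∈ ⨆ (k : ℕ) (_ : n ≤ k + 1), 𝒜 k)
    (hspan : ∀ m : ℕ, 𝒜 (m + 1) ≤ Submodule.span K
      {x | ∃ f ∈ 𝒜 1, ∃ a ∈ 𝒜 m, S f a - x ∈ ⨆ (j : ℕ) (_ : j + 1 = m), 𝒜 j})
    (m n : ℕ) (a b : A) (ha : a ∈ 𝒜 m) (hb : b ∈ 𝒜 n) :
    S a b ∈ ⨆ (k : ℕ) (_ : n ≤ k + m), 𝒜 k := by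
  induction m using Nat.strong_induction_on generalizing a with
  | _ m ih =>
    rcases m with _ | m
    · exact Submodule.mem_iSup_of_mem n (Submodule.mem_iSup_of_mem (by omega) (hzero a ha n b hb))
    · suffices h : Submodule.span K
          {x | ∃ f ∈ 𝒜 1, ∃ a ∈ 𝒜 m, S f a - x ∈ ⨆ (j : ℕ) (_ : j + 1 = m), 𝒜 j} ≤
          (⨆ (k : ℕ) (_ : n ≤ k + (m + 1)), 𝒜 k).comap (S.flip b) from h (hspan m ha)
      rw [Submodule.span_le]
      rintro x ⟨f, hf, a', ha', hc⟩
      have hlead : S f (S a' b) ∈ ⨆ (k : ℕ) (_ : n ≤ k + (m + 1)), 𝒜 k := by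
        suffices h : (⨆ (k : ℕ) (_ : n ≤ k + m), 𝒜 k) ≤
            (⨆ (k : ℕ) (_ : n ≤ k + (m + 1)), 𝒜 k).comap (S f) from
          h (ih m (by omega) a' ha')
        refine iSup₂_le fun i hi y hy => ?_
        exact SetLike.le_def.1 (biSup_mono fun k hk => by omega) (hone f hf i y hy)
      have hcorr : S (S f a' - x) b ∈ ⨆ (k : ℕ) (_ : n ≤ k + (m + 1)), 𝒜 k := by
        suffices h : (⨆ (j : ℕ) (_ : j + 1 = m), 𝒜 j) ≤
            (⨆ (k : ℕ) (_ : n ≤ k + (m + 1)), 𝒜 k).comap (S.flip b) from h hc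
        refine iSup₂_le fun i hi y hy => ?_
        exact SetLike.le_def.1 (biSup_mono fun k hk => by omega) (ih i (by omega) y hy)
      have hx : S x b = S f (S a' b) - S (S f a' - x) b := by
        rw [map_sub, LinearMap.sub_apply, hassoc, sub_sub_cancel]
      rw [SetLike.mem_coe, Submodule.mem_comap, LinearMap.flip_apply, hx]
      exact Submodule.sub_mem _ hlead hcorr

/-- Let `A` be an ℕ-graded `K`-algebra generated in degrees `0`
and `1` and let `*` be a `0`-equivariant and `ℤ/2`-equivariant star product on
`A`. Then `*` is short if and only if for all `f ∈ A₁` and `a ∈ Aₙ` the lower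
order terms `f * a - f·a` and `a * f - a·f` lie in `A_{n-1}` (interpreted as `0`
when `n = 0`). -/
theorem short_iff_lower_order_terms_degree_minus_one
    {K A : Type*} [Field K] [Ring A] [Algebra K A]
    (𝒜 : ℕ → Submodule K A) [GradedAlgebra 𝒜]
    (hgen : Algebra.adjoin K ((𝒜 0 : Set A) ∪ (𝒜 1 : Set A)) = ⊤)
    (star : A →ₗ[K] A →ₗ[K] A)
    (hassoc : ∀ a b c : A, star (star a b) c = star a (star b c))
    (hlow : ∀ (m n : ℕ) (a b : A), a ∈ 𝒜 m → b ∈ 𝒜 n →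
      star a b - a * b ∈ ⨆ k < m + n, 𝒜 k)
    (h0eq : ∀ (h a : A), h ∈ 𝒜 0 → star a h = a * h ∧ star h a = h * a)
    (hZ2 : ∀ (m n : ℕ) (a b : A), a ∈ 𝒜 m → b ∈ 𝒜 n →
      star a b ∈ ⨆ k ≤ (m + n) / 2, 𝒜 (m + n - 2 * k)) :
    (∀ (m n : ℕ) (a b : A), a ∈ 𝒜 m → b ∈ 𝒜 n →
        star a b ∈ ⨆ k ∈ Finset.Icc (max m n - min m n) (m + n), 𝒜 k) ↔
      (∀ f ∈ 𝒜 1, ∀ (n : ℕ), ∀ a ∈ 𝒜 n,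
        (star f a - f * a ∈ ⨆ (m : ℕ) (_ : m + 1 = n), 𝒜 m) ∧
        (star a f - a * f ∈ ⨆ (m : ℕ) (_ : m + 1 = n), 𝒜 m)) := by
  constructor
  · intro hshort
    have lower_terms : ∀ (m n r : ℕ) (a b : A), a ∈ 𝒜 m → b ∈ 𝒜 n → m + n = r + 1 →
        r ≤ max m n - min m n + 1 → star a b - a * b ∈ ⨆ (j : ℕ) (_ : j + 1 = r), 𝒜 j := by
      intro m n r a b ha hb hr hmn
      have hab : a * b ∈ 𝒜 (m + n) := SetLike.mul_mem_graded ha hb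
      have hparity : star a b ∈ ⨆ (j : ℕ) (_ : ∃ k ≤ (m + n) / 2, j = m + n - 2 * k), 𝒜 j :=
        (iSup₂_le fun k hk => le_iSup₂_of_le (m + n - 2 * k) ⟨k, hk, rfl⟩ le_rfl :
          (⨆ k ≤ (m + n) / 2, 𝒜 (m + n - 2 * k)) ≤ _) (hZ2 m n a b ha hb)
      rw [mem_iSup_graded_iff] at hparity ⊢
      intro k hk
      by_cases hlt : k < m + n
      · rw [DirectSum.decompose_sub, DirectSum.sub_apply, AddSubgroupClass.coe_sub,
          DirectSum.decompose_of_mem_ne 𝒜 hab (by omega), sub_zero]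
        by_cases hpar : ∃ l ≤ (m + n) / 2, k = m + n - 2 * l
        · refine (mem_iSup_graded_iff 𝒜 _ _).1 (hshort m n a b ha hb) k ?_
          rw [Finset.mem_Icc]
          omega
        · exact hparity k hpar
      · exact (mem_iSup_graded_iff 𝒜 _ _).1 (hlow m n a b ha hb) k hlt
    intro f hf n a ha
    rcases n with _ | n
    · simp [(h0eq a f ha).1, (h0eq a f ha).2]
    · exact ⟨lower_terms 1 (n + 1) (n + 1) f a hf ha (by omega) (by omega),
        lower_terms (n + 1) 1 (n + 1) a f ha hf (by omega) (by omega)⟩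
  · intro h m n a b ha hb
    have lowers_by_one : ∀ (n : ℕ) (x y : A), y ∈ 𝒜 (n + 1) →
        x - y ∈ (⨆ (m : ℕ) (_ : m + 1 = n), 𝒜 m) → x ∈ ⨆ (k : ℕ) (_ : n ≤ k + 1), 𝒜 k := by
      intro n x y hy hxy
      rw [← sub_add_cancel x y]
      refine Submodule.add_mem _ ?_ ?_
      · exact SetLike.le_def.1 (biSup_mono fun i hi => by omega) hxy
      · exact (le_iSup₂_of_le (n + 1) (by omega) le_rfl :
          𝒜 (n + 1) ≤ ⨆ (k : ℕ) (_ : n ≤ k + 1), 𝒜 k) hy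
    have hleft : star a b ∈ ⨆ (k : ℕ) (_ : n ≤ k + m), 𝒜 k := by
      refine mul_mem_iSup_ge_of_degree_one 𝒜 star hassoc ?_ ?_ ?_ m n a b ha hb
      · intro x hx n y hy
        rw [(h0eq x y hx).2]
        simpa using SetLike.mul_mem_graded hx hy
      · intro f hf n y hy
        exact lowers_by_one n _ (f * y) (add_comm 1 n ▸ SetLike.mul_mem_graded hf hy)
          (h f hf n y hy).1
      · refine fun m => (graded_succ_le_one_mul 𝒜 hgen m).trans (Submodule.mul_le.2 ?_)
        exact fun f hf y hy => Submodule.subset_span ⟨f, hf, y, hy, (h f hf m y hy).1⟩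
    have hright : star a b ∈ ⨆ (k : ℕ) (_ : m ≤ k + n), 𝒜 k := by
      refine mul_mem_iSup_ge_of_degree_one 𝒜 star.flip (fun x y z => (hassoc z y x).symm)
        ?_ ?_ ?_ n m b a hb ha
      · intro x hx n y hy
        rw [LinearMap.flip_apply, (h0eq x y hx).1]
        simpa using SetLike.mul_mem_graded hy hx
      · intro f hf n y hy
        exact lowers_by_one n _ (y * f) (SetLike.mul_mem_graded hy hf) (h f hf n y hy).2
      · refine fun m => (graded_succ_le_mul_one 𝒜 hgen m).trans (Submodule.mul_le.2 ?_)
        exact fun y hy f hf => Submodule.subset_span ⟨f, hf, y, hy, (h f hf m y hy).2⟩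
    rw [mem_iSup_graded_iff] at hleft hright ⊢
    intro k hk
    rw [Finset.mem_Icc] at hk
    by_cases hupper : m + n < k
    · have hab : a * b ∈ 𝒜 (m + n) := SetLike.mul_mem_graded ha hb
      have hz := (mem_iSup_graded_iff 𝒜 _ _).1 (hlow m n a b ha hb) k (by omega)
      rwa [DirectSum.decompose_sub, DirectSum.sub_apply, AddSubgroupClass.coe_sub,
        DirectSum.decompose_of_mem_ne 𝒜 hab (by omega), sub_zero] at hz
    · by_cases hk' : n ≤ k + m
      · exact hright k (by omega)
      · exact hleft k hk'
end

section
/- Let A be a commutative ℕ-graded K-algebra and * a ℤ/2-equivariant star product on A. For homogeneous a ∈ A_m, b ∈ A_n define {a,b} ∈ A_{m+n−2} to be the homogeneous component of degree m+n−2 of a*b − b*a (zero if m+n < 2). Then {·,·} is a Poisson bracket on A: for all homogeneous a, b, c ∈ A one has antisymmetry {a,b} = −{b,a}, the Leibniz rule {a, bc} = {a,b}·c + b·{a,c}, and the Jacobi identity {a,{b,c}} + {b,{c,a}} + {c,{a,b}} = 0. -/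
/-- For `a ∈ A_m`, `b ∈ A_n`, the bracket `{a,b}`: the homogeneous component of
degree `m + n - 2` of `a * b - b * a` (zero when `m + n < 2`). -/
noncomputable def starBracket {K A : Type*} [Field K] [CommRing A] [Algebra K A]
    (𝒜 : ℕ → Submodule K A) [GradedAlgebra 𝒜]
    (star : A →ₗ[K] A →ₗ[K] A) (m n : ℕ) (a b : A) : A :=
  if m + n < 2 then 0
  else (DirectSum.decompose 𝒜 (star a b - star b a) (m + n - 2) : A)

section DegreeFiltration

variable {K A : Type*} [Field K] [CommRing A] [Algebra K A]
  (𝒜 : ℕ → Submodule K A) [GradedAlgebra 𝒜]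

/-- The elements all of whose homogeneous components have degree at most `d`. Indexing by `ℤ`
makes the filtration zero in negative degrees. -/
def degreeLE (d : ℤ) : Submodule K A :=
  ⨅ (k : ℕ) (_ : d < k), LinearMap.ker (GradedAlgebra.proj 𝒜 k)

/-- The homogeneous elements of degree `d`, the only one being `0` when `d < 0`. -/
def degreeEq (d : ℤ) : Submodule K A :=
  ⨅ (k : ℕ) (_ : (k : ℤ) ≠ d), LinearMap.ker (GradedAlgebra.proj 𝒜 k)

variable {𝒜}

theorem mem_degreeLE {d : ℤ} {x : A} :
    x ∈ degreeLE 𝒜 d ↔ ∀ k : ℕ, d < k → GradedAlgebra.proj 𝒜 k x = 0 := by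
  simp [degreeLE, Submodule.mem_iInf]

theorem mem_degreeEq {d : ℤ} {x : A} :
    x ∈ degreeEq 𝒜 d ↔ ∀ k : ℕ, (k : ℤ) ≠ d → GradedAlgebra.proj 𝒜 k x = 0 := by
  simp [degreeEq, Submodule.mem_iInf]

theorem eq_zero_of_proj_eq_zero {x : A} (h : ∀ k, GradedAlgebra.proj 𝒜 k x = 0) : x = 0 := by
  classical
  rw [← DirectSum.sum_support_decompose 𝒜 x]
  exact Finset.sum_eq_zero fun k _ => h k

theorem proj_eq_zero_of_mem {i k : ℕ} {x : A} (hx : x ∈ 𝒜 i) (h : i ≠ k) :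
    GradedAlgebra.proj 𝒜 k x = 0 := by
  rw [GradedAlgebra.proj_apply]
  exact DirectSum.decompose_of_mem_ne 𝒜 hx h

theorem mem_degreeLE_of_mem {i : ℕ} {d : ℤ} {x : A} (hx : x ∈ 𝒜 i) (h : (i : ℤ) ≤ d) :
    x ∈ degreeLE 𝒜 d :=
  mem_degreeLE.2 fun _ hk => proj_eq_zero_of_mem hx (by omega)

theorem mem_degreeEq_of_mem {i : ℕ} {d : ℤ} {x : A} (hx : x ∈ 𝒜 i) (h : (i : ℤ) = d) :
    x ∈ degreeEq 𝒜 d :=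
  mem_degreeEq.2 fun _ hk => proj_eq_zero_of_mem hx (by omega)

theorem degreeLE_mono {d e : ℤ} (h : d ≤ e) : degreeLE 𝒜 d ≤ degreeLE 𝒜 e :=
  fun _ hx => mem_degreeLE.2 fun k hk => mem_degreeLE.1 hx k (by omega)

theorem eq_zero_of_mem_degreeLE_of_neg {d : ℤ} {x : A} (hd : d < 0) (hx : x ∈ degreeLE 𝒜 d) :
    x = 0 :=
  eq_zero_of_proj_eq_zero fun k => mem_degreeLE.1 hx k (by omega)

theorem eq_zero_of_mem_degreeEq_of_mem_degreeLE {d e : ℤ} {x : A} (h : e < d)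
    (hx : x ∈ degreeEq 𝒜 d) (hx' : x ∈ degreeLE 𝒜 e) : x = 0 :=
  eq_zero_of_proj_eq_zero fun k => by
    by_cases hk : (k : ℤ) = d
    · exact mem_degreeLE.1 hx' k (by omega)
    · exact mem_degreeEq.1 hx k hk

theorem degreeLE_le {d : ℤ} {p : Submodule K A} (h : ∀ k : ℕ, (k : ℤ) ≤ d → 𝒜 k ≤ p) :
    degreeLE 𝒜 d ≤ p := by
  classical
  intro x hx
  rw [← DirectSum.sum_support_decompose 𝒜 x]
  refine p.sum_mem fun k _ => ?_
  by_cases hk : (k : ℤ) ≤ d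
  · exact h k hk (SetLike.coe_mem _)
  · have hz := mem_degreeLE.1 hx k (by omega)
    rw [GradedAlgebra.proj_apply] at hz
    rw [hz]
    exact p.zero_mem

/-- A bilinear map that shifts degrees of homogeneous elements by at most `e` does so on the
whole filtration. -/
theorem apply_mem_degreeLE (f : A →ₗ[K] A →ₗ[K] A) {e : ℤ}
    (hf : ∀ (m n : ℕ) (a b : A), a ∈ 𝒜 m → b ∈ 𝒜 n → f a b ∈ degreeLE 𝒜 (m + n + e))
    {i j d : ℤ} {x y : A} (hx : x ∈ degreeLE 𝒜 i) (hy : y ∈ degreeLE 𝒜 j)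
    (hd : i + j + e ≤ d) : f x y ∈ degreeLE 𝒜 d := by
  have key : degreeLE 𝒜 i ≤ (degreeLE 𝒜 d).comap (f.flip y) := degreeLE_le fun m hm a ha => by
    have : degreeLE 𝒜 j ≤ (degreeLE 𝒜 d).comap (f a) := degreeLE_le fun n hn b hb =>
      degreeLE_mono (by omega) (hf m n a b ha hb)
    exact this hy
  exact key hx

theorem mul_mem_degreeLE {i j d : ℤ} {x y : A} (hx : x ∈ degreeLE 𝒜 i)
    (hy : y ∈ degreeLE 𝒜 j) (hd : i + j ≤ d) : x * y ∈ degreeLE 𝒜 d :=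
  apply_mem_degreeLE (LinearMap.mul K A) (e := 0)
    (fun _ _ _ _ ha hb => mem_degreeLE_of_mem (SetLike.mul_mem_graded ha hb) (by simp))
    hx hy (by omega)

theorem mul_mem_degreeEq {m : ℕ} {d e : ℤ} {x y : A} (hx : x ∈ 𝒜 m)
    (hy : y ∈ degreeEq 𝒜 d) (he : m + d = e) : x * y ∈ degreeEq 𝒜 e := by
  classical
  rw [← DirectSum.sum_support_decompose 𝒜 y, Finset.mul_sum]
  refine Submodule.sum_mem _ fun k _ => ?_
  by_cases hk : (k : ℤ) = d
  · exact mem_degreeEq_of_mem (SetLike.mul_mem_graded hx (SetLike.coe_mem _))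
      (by push_cast; omega)
  · have hz := mem_degreeEq.1 hy k hk
    rw [GradedAlgebra.proj_apply] at hz
    rw [hz, mul_zero]
    exact Submodule.zero_mem _

end DegreeFiltration

section StarProduct

variable {K A : Type*} [Field K] [CommRing A] [Algebra K A]
  {𝒜 : ℕ → Submodule K A} [GradedAlgebra 𝒜] {star : A →ₗ[K] A →ₗ[K] A}

/-- By equivariance, a star product agrees with the product up to terms of degree lower by two. -/
theorem star_sub_mul_mem_of_mem
    (hlow : ∀ (m n : ℕ) (a b : A), a ∈ 𝒜 m → b ∈ 𝒜 n →
      star a b - a * b ∈ ⨆ k < m + n, 𝒜 k)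
    (hZ2 : ∀ (m n : ℕ) (a b : A), a ∈ 𝒜 m → b ∈ 𝒜 n →
      star a b ∈ ⨆ k ≤ (m + n) / 2, 𝒜 (m + n - 2 * k))
    (m n : ℕ) (a b : A) (ha : a ∈ 𝒜 m) (hb : b ∈ 𝒜 n) :
    (star - LinearMap.mul K A) a b ∈ degreeLE 𝒜 (m + n + (-2)) := by
  change star a b - a * b ∈ _
  refine mem_degreeLE.2 fun k hk => ?_
  by_cases hk' : k + 1 = m + n
  · have hstar : (⨆ l ≤ (m + n) / 2, 𝒜 (m + n - 2 * l)) ≤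
        LinearMap.ker (GradedAlgebra.proj 𝒜 k) :=
      iSup₂_le fun l hl x hx => proj_eq_zero_of_mem hx (by omega)
    rw [map_sub, hstar (hZ2 m n a b ha hb),
      proj_eq_zero_of_mem (SetLike.mul_mem_graded ha hb) (by omega), sub_zero]
  · have hle : (⨆ l < m + n, 𝒜 l) ≤ LinearMap.ker (GradedAlgebra.proj 𝒜 k) :=
      iSup₂_le fun l hl x hx => proj_eq_zero_of_mem hx (by omega)
    exact hle (hlow m n a b ha hb)

theorem starBracket_mem (m n : ℕ) (a b : A) :
    starBracket 𝒜 star m n a b ∈ 𝒜 (m + n - 2) := by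
  unfold starBracket
  split_ifs
  · exact Submodule.zero_mem _
  · exact SetLike.coe_mem _

theorem starBracket_of_lt {m n : ℕ} (h : m + n < 2) (a b : A) :
    starBracket 𝒜 star m n a b = 0 := by
  simp [starBracket, h]

theorem starBracket_mem_degreeEq (m n : ℕ) (a b : A) :
    starBracket 𝒜 star m n a b ∈ degreeEq 𝒜 (m + n - 2) := by
  by_cases h : m + n < 2
  · rw [starBracket_of_lt h]
    exact Submodule.zero_mem _
  · exact mem_degreeEq_of_mem (starBracket_mem m n a b) (by omega)

theorem starBracket_antisymm (m n : ℕ) (a b : A) :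
    starBracket 𝒜 star m n a b = - starBracket 𝒜 star n m b a := by
  unfold starBracket
  rw [add_comm n m]
  split_ifs
  · simp
  · rw [← neg_sub (star b a) (star a b), DirectSum.decompose_neg]
    rfl

/-- The bracket is the leading term of the commutator. -/
theorem commutator_sub_starBracket_mem {m n : ℕ} {a b : A}
    (h : star a b - star b a ∈ degreeLE 𝒜 (m + n - 2)) :
    star a b - star b a - starBracket 𝒜 star m n a b ∈ degreeLE 𝒜 (m + n - 3) := by
  refine mem_degreeLE.2 fun k hk => ?_
  rw [map_sub]
  by_cases hk' : k + 2 = m + n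
  · obtain rfl : k = m + n - 2 := by omega
    have hb : starBracket 𝒜 star m n a b =
        GradedAlgebra.proj 𝒜 (m + n - 2) (star a b - star b a) := by
      rw [starBracket, if_neg (by omega), GradedAlgebra.proj_apply]
    rw [hb, sub_eq_zero, GradedAlgebra.proj_apply, GradedAlgebra.proj_apply,
      DirectSum.decompose_coe, DirectSum.of_eq_same]
  · rw [mem_degreeLE.1 h k (by omega),
      mem_degreeEq.1 (starBracket_mem_degreeEq m n a b) k (by omega), sub_zero]

section

variable (hD : ∀ (m n : ℕ) (a b : A), a ∈ 𝒜 m → b ∈ 𝒜 n →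
  (star - LinearMap.mul K A) a b ∈ degreeLE 𝒜 (m + n + (-2)))

include hD

theorem star_sub_mul_mem {i j d : ℤ} {x y : A} (hx : x ∈ degreeLE 𝒜 i)
    (hy : y ∈ degreeLE 𝒜 j) (hd : i + j - 2 ≤ d) : star x y - x * y ∈ degreeLE 𝒜 d :=
  apply_mem_degreeLE _ hD hx hy (by omega)

theorem commutator_mem {i j d : ℤ} {x y : A} (hx : x ∈ degreeLE 𝒜 i)
    (hy : y ∈ degreeLE 𝒜 j) (hd : i + j - 2 ≤ d) : star x y - star y x ∈ degreeLE 𝒜 d := by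
  have h := sub_mem (star_sub_mul_mem hD hx hy hd)
    (star_sub_mul_mem hD hy hx (d := d) (by omega))
  rwa [mul_comm y x, sub_sub_sub_cancel_right] at h

theorem commutator_sub_starBracket_mem_of_mem {m n : ℕ} {a b : A} (ha : a ∈ 𝒜 m)
    (hb : b ∈ 𝒜 n) :
    star a b - star b a - starBracket 𝒜 star m n a b ∈ degreeLE 𝒜 (m + n - 3) :=
  commutator_sub_starBracket_mem <| commutator_mem hD (mem_degreeLE_of_mem ha le_rfl)
    (mem_degreeLE_of_mem hb le_rfl) le_rfl

theorem starBracket_leibniz (hassoc : ∀ a b c : A, star (star a b) c = star a (star b c))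
    {m n p : ℕ} {a b c : A} (ha : a ∈ 𝒜 m) (hb : b ∈ 𝒜 n) (hc : c ∈ 𝒜 p) :
    starBracket 𝒜 star m (n + p) a (b * c) =
      starBracket 𝒜 star m n a b * c + b * starBracket 𝒜 star m p a c := by
  have ha' := mem_degreeLE_of_mem ha le_rfl
  have hb' := mem_degreeLE_of_mem hb le_rfl
  have hc' := mem_degreeLE_of_mem hc le_rfl
  have hbc := SetLike.mul_mem_graded hb hc
  rw [← sub_eq_zero]
  refine eq_zero_of_mem_degreeEq_of_mem_degreeLE (𝒜 := 𝒜) (d := m + n + p - 2)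
    (e := m + n + p - 3) (by omega) ?_ ?_
  · refine sub_mem ?_ (add_mem ?_ ?_)
    · convert starBracket_mem_degreeEq m (n + p) a (b * c) using 2
      push_cast
      ring
    · rw [mul_comm]
      exact mul_mem_degreeEq hc (starBracket_mem_degreeEq m n a b) (by omega)
    · exact mul_mem_degreeEq hb (starBracket_mem_degreeEq m p a c) (by omega)
  · have hab := commutator_mem hD ha' hb' le_rfl
    have hac := commutator_mem hD ha' hc' le_rfl
    have h₁ := degreeLE_mono (e := m + n + p - 3) (by push_cast; omega)
      (commutator_sub_starBracket_mem_of_mem hD ha hbc)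
    have h₂ := commutator_mem hD (d := m + n + p - 3) ha'
      (star_sub_mul_mem hD hb' hc' le_rfl) (by omega)
    have h₃ := star_sub_mul_mem hD (d := m + n + p - 3) hab hc' (by omega)
    have h₄ := star_sub_mul_mem hD (d := m + n + p - 3) hb' hac (by omega)
    have h₅ := mul_mem_degreeLE (d := m + n + p - 3)
      (commutator_sub_starBracket_mem_of_mem hD ha hb) hc' (by omega)
    have h₆ := mul_mem_degreeLE (d := m + n + p - 3) hb'
      (commutator_sub_starBracket_mem_of_mem hD ha hc) (by omega)
    convert sub_mem (add_mem (add_mem h₃ h₅) (add_mem h₄ h₆)) (add_mem h₁ h₂) using 1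
    simp only [map_sub, LinearMap.sub_apply, hassoc]
    ring

theorem starBracket_starBracket_mem {m n p : ℕ} {a b c : A} (ha : a ∈ 𝒜 m) (hb : b ∈ 𝒜 n)
    (hc : c ∈ 𝒜 p) :
    starBracket 𝒜 star m (n + p - 2) a (starBracket 𝒜 star n p b c) ∈
        degreeEq 𝒜 (m + n + p - 4) ∧
      star a (star b c - star c b) - star (star b c - star c b) a -
        starBracket 𝒜 star m (n + p - 2) a (starBracket 𝒜 star n p b c) ∈
        degreeLE 𝒜 (m + n + p - 5) := by
  have hbc := commutator_mem hD (mem_degreeLE_of_mem hb le_rfl)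
    (mem_degreeLE_of_mem hc le_rfl) le_rfl
  by_cases h : n + p < 2
  · have hz : starBracket 𝒜 star m (n + p - 2) a 0 = 0 := by simp [starBracket]
    rw [starBracket_of_lt h, hz, eq_zero_of_mem_degreeLE_of_neg (by omega) hbc]
    simp
  · constructor
    · convert starBracket_mem_degreeEq m (n + p - 2) a (starBracket 𝒜 star n p b c) using 2
      omega
    · have h₁ := degreeLE_mono (e := m + n + p - 5) (by omega)
        (commutator_sub_starBracket_mem_of_mem hD ha (starBracket_mem (star := star) n p b c))
      have h₂ := commutator_mem hD (d := m + n + p - 5) (mem_degreeLE_of_mem ha le_rfl)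
        (commutator_sub_starBracket_mem_of_mem hD hb hc) (by omega)
      convert add_mem h₁ h₂ using 1
      simp only [map_sub, LinearMap.sub_apply]
      ring

theorem starBracket_jacobi (hassoc : ∀ a b c : A, star (star a b) c = star a (star b c))
    {m n p : ℕ} {a b c : A} (ha : a ∈ 𝒜 m) (hb : b ∈ 𝒜 n) (hc : c ∈ 𝒜 p) :
    starBracket 𝒜 star m (n + p - 2) a (starBracket 𝒜 star n p b c) +
      starBracket 𝒜 star n (p + m - 2) b (starBracket 𝒜 star p m c a) +
      starBracket 𝒜 star p (m + n - 2) c (starBracket 𝒜 star m n a b) = 0 := by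
  obtain ⟨h₁, h₁'⟩ := starBracket_starBracket_mem hD ha hb hc
  obtain ⟨h₂, h₂'⟩ := starBracket_starBracket_mem hD hb hc ha
  obtain ⟨h₃, h₃'⟩ := starBracket_starBracket_mem hD hc ha hb
  rw [show (n + p + m : ℤ) = m + n + p by ring] at h₂ h₂'
  rw [show (p + m + n : ℤ) = m + n + p by ring] at h₃ h₃'
  refine eq_zero_of_mem_degreeEq_of_mem_degreeLE (d := m + n + p - 4) (e := m + n + p - 5)
    (by omega) (add_mem (add_mem h₁ h₂) h₃) ?_
  convert neg_mem (add_mem (add_mem h₁' h₂') h₃') using 1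
  simp only [map_sub, LinearMap.sub_apply, hassoc]
  ring

end

end StarProduct

/-- For a `ℤ/2`-equivariant star product `*` on a commutative
ℕ-graded `K`-algebra `A`, the bracket `{a,b}` (the degree `m+n-2` component of
`a*b - b*a` for `a ∈ A_m`, `b ∈ A_n`) is a Poisson bracket: it is antisymmetric,
satisfies the Leibniz rule and the Jacobi identity on homogeneous elements. -/
theorem starBracket_poisson
    {K A : Type*} [Field K] [CommRing A] [Algebra K A]
    (𝒜 : ℕ → Submodule K A) [GradedAlgebra 𝒜]
    (star : A →ₗ[K] A →ₗ[K] A)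
    (hassoc : ∀ a b c : A, star (star a b) c = star a (star b c))
    (hlow : ∀ (m n : ℕ) (a b : A), a ∈ 𝒜 m → b ∈ 𝒜 n →
      star a b - a * b ∈ ⨆ k < m + n, 𝒜 k)
    (hZ2 : ∀ (m n : ℕ) (a b : A), a ∈ 𝒜 m → b ∈ 𝒜 n →
      star a b ∈ ⨆ k ≤ (m + n) / 2, 𝒜 (m + n - 2 * k)) :
    (∀ (m n : ℕ) (a b : A), a ∈ 𝒜 m → b ∈ 𝒜 n →
      starBracket 𝒜 star m n a b = - starBracket 𝒜 star n m b a) ∧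
    (∀ (m n p : ℕ) (a b c : A), a ∈ 𝒜 m → b ∈ 𝒜 n → c ∈ 𝒜 p →
      starBracket 𝒜 star m (n + p) a (b * c) =
        starBracket 𝒜 star m n a b * c + b * starBracket 𝒜 star m p a c) ∧
    (∀ (m n p : ℕ) (a b c : A), a ∈ 𝒜 m → b ∈ 𝒜 n → c ∈ 𝒜 p →
      starBracket 𝒜 star m (n + p - 2) a (starBracket 𝒜 star n p b c) +
        starBracket 𝒜 star n (p + m - 2) b (starBracket 𝒜 star p m c a) +
        starBracket 𝒜 star p (m + n - 2) c (starBracket 𝒜 star m n a b) = 0) := by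
  have hD := star_sub_mul_mem_of_mem hlow hZ2
  exact ⟨fun m n a b _ _ => starBracket_antisymm m n a b,
    fun _ _ _ _ _ _ => starBracket_leibniz hD hassoc,
    fun _ _ _ _ _ _ => starBracket_jacobi hD hassoc⟩
end
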